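/- Let d be an odd prime and let c_0 ∈ ℂ be a root of the Gleason polynomial G_{d,n} for some n ≥ 2. Set K = ℚ(c_0). Then there exists N ≥ 1 such that the Galois group of the splitting field of f_{d,c_0}^N over K is non-abelian; equivalently, the arboreal Galois group G_∞(f_{d,c_0}, 0) is non-abelian. -/

import Mathlib

open Polynomial IntermediateField

noncomputable section

/-- The value sequence `a_i(c)`: `a_0 = 0`, `a_{i+1} = a_i ^ d + c`. -/
def aSeq (d : ℕ) {F : Type*} [CommRing F] (c : F) : ℕ → F
  | 0 => 0
  | i + 1 => aSeq d c i ^ d + c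

/-- The polynomials `a_i ∈ ℤ[c]`: `a_0 = 0`, `a_{i+1} = a_i ^ d + c`. -/
def aPoly (d : ℕ) : ℕ → Polynomial ℤ
  | 0 => 0
  | i + 1 => aPoly d i ^ d + X

/-- Iterates of `f_{d,c} = x^d + c`: `f^0 = x`, `f^{k+1} = f ∘ f^k`. -/
def fIter (d : ℕ) {F : Type*} [CommRing F] (c : F) : ℕ → Polynomial F
  | 0 => X
  | k + 1 => fIter d c k ^ d + C c

/-- `c₀` is a root of the Gleason polynomial `G_{d,n} = ∏_{k ∣ n} a_k^{μ(n/k)}`. -/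
def isGleasonRoot (d n : ℕ) (c₀ : ℂ) : Prop :=
  ∃ g : Polynomial ℤ,
    g * ∏ k ∈ n.divisors, aPoly d k ^ ((-(ArithmeticFunction.moebius (n / k))).toNat)
        = ∏ k ∈ n.divisors, aPoly d k ^ ((ArithmeticFunction.moebius (n / k)).toNat)
    ∧ Polynomial.aeval c₀ g = 0

/-- `c₀` is a root of the Misiurewicz polynomial `G_{d,m,n}^ζ`. -/
def isMisiurewiczRoot (d m n : ℕ) (ζ c₀ : ℂ) : Prop :=
  ∃ g : Polynomial ℂ,
    g * ((∏ k ∈ n.divisors,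
            ((aPoly d (m + k - 1)).map (Int.castRingHom ℂ) -
              C ζ * (aPoly d (m - 1)).map (Int.castRingHom ℂ))
                ^ ((-(ArithmeticFunction.moebius (n / k))).toNat)) *
          (if n ∣ (m - 1) then
            ∏ k ∈ n.divisors, ((aPoly d k).map (Int.castRingHom ℂ))
                ^ ((ArithmeticFunction.moebius (n / k)).toNat)
          else 1))
        = (∏ k ∈ n.divisors,
            ((aPoly d (m + k - 1)).map (Int.castRingHom ℂ) -
              C ζ * (aPoly d (m - 1)).map (Int.castRingHom ℂ))
                ^ ((ArithmeticFunction.moebius (n / k)).toNat)) *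
          (if n ∣ (m - 1) then
            ∏ k ∈ n.divisors, ((aPoly d k).map (Int.castRingHom ℂ))
                ^ ((-(ArithmeticFunction.moebius (n / k))).toNat)
          else 1)
    ∧ g.eval c₀ = 0

/-- The polynomial `F_{k,i}^{(d,c₀)} = ∏_{j=1}^{d-1} (f_{d,c₀}^k - ζ^j a_i(c₀))` over `ℂ`. -/
def FPoly (d : ℕ) (c₀ ζ : ℂ) (k i : ℕ) : Polynomial ℂ :=
  ∏ j ∈ Finset.Icc 1 (d - 1), (fIter d c₀ k - C (ζ ^ j * aSeq d c₀ i))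

/-- If Frobenius is surjective modulo a divisor `q` of the prime `p`, then `R ⧸ (q)` is reduced. -/
theorem dvd_of_dvd_pow_of_closure_eq_top {R : Type*} [CommRing R] [IsNoetherianRing R]
    {p : ℕ} (hp : p.Prime) {q : R} (hq : q ∣ (p : R)) {s : Set R} (hs : Subring.closure s = ⊤)
    (hpow : ∀ x ∈ s, ∃ y, q ∣ x - y ^ p) {x : R} {k : ℕ} (hx : q ∣ x ^ k) : q ∣ x := by
  have : Fact p.Prime := ⟨hp⟩
  have hdvd (a : R) : q ∣ a ↔ Ideal.Quotient.mk (Ideal.span {q}) a = 0 := by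
    rw [Ideal.Quotient.eq_zero_iff_mem, Ideal.mem_span_singleton]
  cases subsingleton_or_nontrivial (R ⧸ Ideal.span {q}) with
  | inl h => rw [hdvd]; exact Subsingleton.elim _ _
  | inr h =>
  have : CharP (R ⧸ Ideal.span {q}) p :=
    (CharP.charP_iff_prime_eq_zero hp).2 (by simpa using (hdvd _).1 hq)
  have hsurj : Function.Surjective (frobenius (R ⧸ Ideal.span {q}) p) := by
    intro z
    obtain ⟨z, rfl⟩ := Ideal.Quotient.mk_surjective z
    have hle : Subring.closure s ≤
        (frobenius (R ⧸ Ideal.span {q}) p).range.comap (Ideal.Quotient.mk (Ideal.span {q})) := by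
      rw [Subring.closure_le]
      intro x hx
      obtain ⟨y, hy⟩ := hpow x hx
      refine ⟨Ideal.Quotient.mk _ y, ?_⟩
      rw [hdvd, map_sub, sub_eq_zero, map_pow] at hy
      rw [hy, frobenius_def]
    rw [hs] at hle
    exact hle (Subring.mem_top z)
  obtain ⟨m, hm⟩ := IsNoetherianRing.isNilpotent_nilradical (R ⧸ Ideal.span {q})
  obtain ⟨z, hz⟩ := hsurj.iterate m (Ideal.Quotient.mk _ x)
  rw [iterate_frobenius] at hz
  have hznil : z ∈ nilradical (R ⧸ Ideal.span {q}) := by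
    rw [mem_nilradical]
    refine ⟨p ^ m * k, ?_⟩
    rw [pow_mul, hz, ← map_pow, ← hdvd]
    exact hx
  have hzm : z ^ m = 0 := by
    simpa [hm] using Ideal.pow_mem_pow hznil m
  rw [hdvd, ← hz]
  exact pow_eq_zero_of_le (Nat.lt_pow_self hp.one_lt).le hzm

/-- In a Noetherian domain of which an odd non-unit `p` generates a radical ideal, no
nontrivial quotient of two elements is a `p`-th root of unity congruent to `1`. -/
theorem eq_zero_of_add_pow_eq_pow {R : Type*} [CommRing R] [IsDomain R] [IsNoetherianRing R]
    [CharZero R] {p : ℕ} (hp : p.Prime) (hodd : Odd p) (hunit : ¬ IsUnit (p : R))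
    (hred : ∀ (x : R) (k : ℕ), (p : R) ∣ x ^ k → (p : R) ∣ x)
    {a b : R} (hb : b ≠ 0) (h : (a + b) ^ p = b ^ p) : a = 0 := by
  by_contra ha
  have hp0 : (p : R) ≠ 0 := by exact_mod_cast hp.ne_zero
  have step (a b : R) (ha : a ≠ 0) (h : (a + b) ^ p = b ^ p) : (p : R) ∣ a ∧ (p : R) ∣ b := by
    obtain ⟨r, hr⟩ := exists_add_pow_prime_eq hp a b
    obtain ⟨a, rfl⟩ := hred a p ⟨-(a * b * r), by linear_combination h - hr⟩
    refine ⟨dvd_mul_right _ _, hred b (p - 1) ?_⟩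
    have hsum := odd_sq_dvd_geom_sum₂_sub (a := b) (b := a) hodd
    have hzero : ∑ i ∈ Finset.range p, (b + p * a) ^ i * b ^ (p - 1 - i) = 0 := by
      have := (Commute.all (b + p * a) b).geom_sum₂_mul p
      rw [add_comm b, h, sub_self, add_sub_cancel_right] at this
      rw [add_comm b]
      exact (mul_eq_zero.1 this).resolve_right ha
    rw [hzero, zero_sub, dvd_neg, sq] at hsum
    exact (mul_dvd_mul_iff_left hp0).1 hsum
  have main (k : ℕ) : ∀ a b : R, a ≠ 0 → (a + b) ^ p = b ^ p → (p : R) ^ k ∣ b := by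
    induction k with
    | zero => simp
    | succ k ih =>
      intro a b ha h
      obtain ⟨⟨a, rfl⟩, ⟨b, rfl⟩⟩ := step a b ha h
      rw [pow_succ', mul_dvd_mul_iff_left hp0]
      refine ih a b (right_ne_zero_of_mul ha) ?_
      rw [← mul_add, mul_pow, mul_pow] at h
      exact mul_left_cancel₀ (pow_ne_zero _ hp0) h
  obtain ⟨k, hk⟩ := FiniteMultiplicity.of_not_isUnit hunit hb
  exact hk (main _ a b ha h)

theorem pow_mul_ne_pow_mul_of_not_dvd {R : Type*} [CommRing R] [IsDomain R] [IsNoetherianRing R]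
    {q : R} (hq : q ≠ 0) (hunit : ¬ IsUnit q) (hred : ∀ (x : R) (k : ℕ), q ∣ x ^ k → q ∣ x)
    {p r : ℕ} (hr : ¬ p ∣ r) {a b u : R} (ha : a ≠ 0) (hb : b ≠ 0) (hu : IsUnit u) :
    a ^ p * u ≠ b ^ p * q ^ r := by
  intro h
  obtain ⟨a', ha, ha'⟩ :=
    (FiniteMultiplicity.of_not_isUnit hunit ha).exists_eq_pow_mul_and_not_dvd
  obtain ⟨b', hb, hb'⟩ :=
    (FiniteMultiplicity.of_not_isUnit hunit hb).exists_eq_pow_mul_and_not_dvd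
  generalize multiplicity q a = i at ha
  generalize multiplicity q b = j at hb
  subst ha hb
  have h' : q ^ (i * p) * (a' ^ p * u) = q ^ (j * p + r) * b' ^ p := by
    rw [pow_add, pow_mul, pow_mul]
    linear_combination h
  rcases lt_trichotomy (i * p) (j * p + r) with hlt | heq | hlt
  · obtain ⟨e, he⟩ := Nat.exists_eq_add_of_lt hlt
    rw [he, add_assoc, pow_add, mul_assoc] at h'
    have := mul_left_cancel₀ (pow_ne_zero _ hq) h'
    refine ha' (hred a' p ?_)
    rw [← hu.dvd_mul_right, this, pow_succ', mul_assoc]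
    exact dvd_mul_right _ _
  · exact hr ((Nat.dvd_add_right (dvd_mul_left p j)).1 (heq ▸ dvd_mul_left p i))
  · obtain ⟨e, he⟩ := Nat.exists_eq_add_of_lt hlt
    rw [he, add_assoc, pow_add, mul_assoc] at h'
    have := mul_left_cancel₀ (pow_ne_zero _ hq) h'
    refine hb' (hred b' p ?_)
    rw [← this, pow_succ', mul_assoc]
    exact dvd_mul_right _ _

theorem Subring.closure_preimage_coe_eq_top {R : Type*} [Ring R] {s : Set R} :
    Subring.closure (((↑) : Subring.closure s → R) ⁻¹' s) = ⊤ := by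
  refine eq_top_iff.2 fun x _ ↦ ?_
  obtain ⟨x, hx⟩ := x
  induction hx using Subring.closure_induction with
  | mem x hx => exact Subring.subset_closure hx
  | zero => exact zero_mem _
  | one => exact one_mem _
  | add x y hx hy ihx ihy => exact add_mem (ihx trivial) (ihy trivial)
  | neg x hx ih => exact neg_mem (ih trivial)
  | mul x y hx hy ihx ihy => exact mul_mem (ihx trivial) (ihy trivial)

theorem mul_ne_one_of_isIntegral {E : Type*} [Field E] [CharZero E] {p : ℕ} (hp : p ≠ 1) {x : E}
    (hx : IsIntegral ℤ x) : (p : E) * x ≠ 1 := by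
  intro h
  have hp0 : (p : E) ≠ 0 := left_ne_zero_of_mul_eq_one h
  have hx' : x = algebraMap ℚ E (p : ℚ)⁻¹ := by
    rw [map_inv₀, map_natCast, eq_inv_of_mul_eq_one_right h]
  rw [hx', isIntegral_algebraMap_iff (algebraMap ℚ E).injective] at hx
  obtain ⟨m, hm⟩ := IsIntegrallyClosed.isIntegral_iff.1 hx
  have hpm : (p : ℤ) * m = 1 := by
    have : (p : ℚ) * m = 1 := by
      rw [← eq_intCast (algebraMap ℤ ℚ), hm, mul_inv_cancel₀]
      exact_mod_cast (Nat.cast_ne_zero (R := E)).1 hp0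
    exact_mod_cast this
  exact hp (by simpa using Int.isUnit_iff.1 (IsUnit.of_mul_eq_one _ hpm))

theorem not_isUnit_natCast_closure {E : Type*} [Field E] [CharZero E] {s : Set E}
    (hs : ∀ x ∈ s, IsIntegral ℤ x) {p : ℕ} (hp : p ≠ 1) :
    ¬ IsUnit (p : Subring.closure s) := by
  intro h
  obtain ⟨x, hx⟩ := h.exists_right_inv
  have hle : Subring.closure s ≤ (integralClosure ℤ E).toSubring := Subring.closure_le.2 hs
  exact mul_ne_one_of_isIntegral hp (hle x.2) (by exact_mod_cast congrArg Subtype.val hx)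

/-- A number field generated by an integral element `c` that is a `p`-th power in `ℤ[c]`
contains no primitive `p`-th root of unity. -/
theorem IsPrimitiveRoot.notMem_subfieldClosure {E : Type*} [Field E] [CharZero E] {p : ℕ}
    (hp : p.Prime) (hodd : Odd p) {c e ζ : E} (hc : IsIntegral ℤ c)
    (he : e ∈ Subring.closure {c}) (hce : c = e ^ p) (hζ : IsPrimitiveRoot ζ p) :
    ζ ∉ Subfield.closure {c} := by
  intro hmem
  have hnoeth := is_noetherian_subring_closure {c} (Set.finite_singleton c)
  obtain ⟨a, ha, b, hb, hab⟩ := Subfield.mem_closure_iff.1 hmem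
  have hb0 : b ≠ 0 := by
    rintro rfl
    exact hζ.ne_zero hp.ne_zero (by simpa using hab.symm)
  have hsub : (⟨a - b, sub_mem ha hb⟩ : Subring.closure {c}) = 0 := by
    refine eq_zero_of_add_pow_eq_pow hp hodd
      (not_isUnit_natCast_closure (by simpa using hc) hp.ne_one) (fun x k ↦ ?_)
      (b := ⟨b, hb⟩) (by simpa [Subtype.ext_iff] using hb0) ?_
    · refine dvd_of_dvd_pow_of_closure_eq_top hp dvd_rfl
        (Subring.closure_preimage_coe_eq_top (s := {c})) fun x hx ↦ ?_
      exact ⟨⟨e, he⟩, 0, Subtype.ext (by simp [← hce, Set.mem_singleton_iff.1 hx])⟩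
    · refine Subtype.ext ?_
      have : a = ζ * b := by rw [← hab, div_mul_cancel₀ _ hb0]
      simp [this, mul_pow, hζ.pow_eq_one]
  have : a = b := sub_eq_zero.1 (congrArg Subtype.val hsub)
  rw [this, div_self hb0] at hab
  exact hζ.ne_one hp.one_lt hab.symm

theorem pow_mul_ne_sub_one_pow {E : Type*} [Field E] [CharZero E] {p t : ℕ}
    (hp : p.Prime) {c e ζ w : E} (hc : IsIntegral ℤ c)
    (he : e ∈ Subring.closure {c}) (hce : c = e ^ p) (hζ : IsPrimitiveRoot ζ p)
    (ht : 1 < t) (htp : t < p) (hw : w ∈ Subfield.closure {c, ζ}) :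
    w ^ p * (ζ ^ t - 1) ≠ (ζ - 1) ^ t := by
  intro h
  have hnoeth := is_noetherian_subring_closure {c, ζ} (Set.toFinite _)
  have hcop : t.Coprime p := (Nat.coprime_of_lt_prime (by lia) htp hp).symm
  set R := Subring.closure {c, ζ}
  let z : R := ⟨ζ, Subring.subset_closure (by simp)⟩
  have hz : IsPrimitiveRoot z p := hζ.of_map_of_injective (f := R.subtype) R.subtype_injective
  have hζ1 : ζ - 1 ≠ 0 := sub_ne_zero.2 (hζ.ne_one hp.one_lt)
  have hz1 : z - 1 ≠ 0 := sub_ne_zero.2 (hz.ne_one hp.one_lt)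
  have hdvd : z - 1 ∣ (p : R) :=
    sub_one_dvd_natCast_of_pow_eq_one hz.pow_eq_one (hz.ne_one hp.one_lt)
  have hunit : ¬ IsUnit (z - 1) := by
    intro hu
    have hζint : IsIntegral ℤ ζ := hζ.isIntegral hp.pos
    refine not_isUnit_natCast_closure (s := {c, ζ}) (by simp [hc, hζint]) hp.ne_one ?_
    obtain ⟨r, hr⟩ := exists_add_pow_prime_eq hp (z - 1) 1
    have : (p : R) ∣ (z - 1) ^ p := by
      refine ⟨-((z - 1) * r), ?_⟩
      rw [sub_add_cancel, hz.pow_eq_one] at hr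
      linear_combination -hr
    exact isUnit_of_dvd_unit this (hu.pow p)
  have hred (x : R) (k : ℕ) : z - 1 ∣ x ^ k → z - 1 ∣ x := by
    refine dvd_of_dvd_pow_of_closure_eq_top hp hdvd
      (Subring.closure_preimage_coe_eq_top (s := {c, ζ})) ?_
    rintro x (hx | hx)
    · refine ⟨⟨e, Subring.closure_mono (by simp) he⟩, 0, Subtype.ext ?_⟩
      simp [hx, ← hce]
    · refine ⟨1, 1, Subtype.ext ?_⟩
      simp [z, Set.mem_singleton_iff.1 hx]
  obtain ⟨u, hu⟩ := hz.associated_sub_one_pow_sub_one_of_coprime hcop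
  have huζ : (ζ - 1) * (u : R) = ζ ^ t - 1 := congrArg Subtype.val hu
  obtain ⟨a, ha, b, hb, hab⟩ := Subfield.mem_closure_iff.1 hw
  have hw0 : w ≠ 0 := by
    rintro rfl
    rw [zero_pow hp.ne_zero, zero_mul] at h
    exact pow_ne_zero _ hζ1 h.symm
  have ha0 : a ≠ 0 := by rintro rfl; simp [← hab] at hw0
  have hb0 : b ≠ 0 := by rintro rfl; simp [← hab] at hw0
  refine pow_mul_ne_pow_mul_of_not_dvd (R := R) hz1 hunit hred (p := p) (r := t - 1)
    (Nat.not_dvd_of_pos_of_lt (by lia) (by lia)) (a := ⟨a, ha⟩) (b := ⟨b, hb⟩)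
    (by simpa [Subtype.ext_iff] using ha0) (by simpa [Subtype.ext_iff] using hb0) u.isUnit
    (Subtype.ext ?_)
  change a ^ p * ((u : R) : E) = b ^ p * (ζ - 1) ^ (t - 1)
  have haw : a = w * b := by rw [← hab, div_mul_cancel₀ _ hb0]
  refine mul_left_cancel₀ hζ1 ?_
  have hpow : (ζ - 1) * (ζ - 1) ^ (t - 1) = (ζ - 1) ^ t := mul_pow_sub_one (by lia) _
  rw [haw, mul_pow]
  linear_combination w ^ p * b ^ p * huζ + b ^ p * h - b ^ p * hpow

/-- The Kummer-type obstruction: `ℚ(c, ζ, (c (ζ - 1))^(1/p))` is not abelian over `ℚ(c)`. -/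
theorem exists_mul_ne_mul_of_pow_eq {K E : Type*} [Field K] [CharZero K] [Field E] [Algebra K E]
    [FiniteDimensional K E] [IsGalois K E] {p : ℕ} (hp : p.Prime) (hodd : Odd p) {c e : K}
    (hc : IsIntegral ℤ c) (hc0 : c ≠ 0) (he : e ∈ Subring.closure {c}) (hce : c = e ^ p)
    (hK : ∀ x : K, x ∈ Subfield.closure {c}) {ζ z : E} (hζ : IsPrimitiveRoot ζ p)
    (hz : z ^ p = (ζ - 1) * algebraMap K E c) : ∃ σ τ : E ≃ₐ[K] E, σ * τ ≠ τ * σ := by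
  by_contra! hcomm
  have : CharZero E := charZero_of_injective_algebraMap (algebraMap K E).injective
  have : NeZero p := ⟨hp.ne_zero⟩
  have hcE : IsIntegral ℤ (algebraMap K E c) := hc.algebraMap
  have hceE : algebraMap K E c = algebraMap K E e ^ p := by rw [← map_pow, ← hce]
  have heE : algebraMap K E e ∈ Subring.closure {algebraMap K E c} := by
    rw [← Set.image_singleton, ← RingHom.map_closure]
    exact ⟨e, he, rfl⟩
  have hKE (x : K) : algebraMap K E x ∈ Subfield.closure {algebraMap K E c} := by
    rw [← Set.image_singleton, ← RingHom.map_field_closure]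
    exact ⟨x, hK x, rfl⟩
  have hc0E : algebraMap K E c ≠ 0 := by simpa using hc0
  have hz0 : z ≠ 0 := by
    rintro rfl
    rw [zero_pow hp.ne_zero] at hz
    exact mul_ne_zero (sub_ne_zero.2 (hζ.ne_one hp.one_lt)) hc0E hz.symm
  have hζK : ζ ∉ Set.range (algebraMap K E) := by
    rintro ⟨x, hx⟩
    exact hζ.notMem_subfieldClosure hp hodd hcE heE hceE (hx ▸ hKE x)
  rw [IsGalois.mem_range_algebraMap_iff_fixed] at hζK
  push Not at hζK
  obtain ⟨σ, hσ⟩ := hζK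
  obtain ⟨t, htp, ht⟩ := hζ.eq_pow_of_pow_eq_one (ξ := σ ζ)
    (by rw [← map_pow, hζ.pow_eq_one, map_one])
  have ht0 : t ≠ 0 := by
    rintro rfl
    rw [pow_zero, ← map_one σ] at ht
    exact hζ.ne_one hp.one_lt (σ.injective ht.symm)
  have ht1 : t ≠ 1 := by
    rintro rfl
    exact hσ (by rw [← ht, pow_one])
  have hσz : σ z ≠ 0 := by simpa using hz0
  have hw : z ^ t / σ z ∈ K⟮ζ⟯ := by
    have : z ^ t / σ z ∈ Set.range (algebraMap K⟮ζ⟯ E) := by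
      rw [IsGalois.mem_range_algebraMap_iff_fixed]
      intro τ'
      let τ : E ≃ₐ[K] E := τ'.restrictScalars K
      change τ (z ^ t / σ z) = _
      have hτζ : τ ζ = ζ := τ'.commutes (AdjoinSimple.gen K ζ)
      obtain ⟨s, -, hs⟩ := hζ.eq_pow_of_pow_eq_one (ξ := τ z / z) (by
        rw [div_pow, ← map_pow, hz, map_mul, map_sub, map_one, hτζ, τ.commutes, div_self]
        rw [← hz]
        exact pow_ne_zero _ hz0)
      have hτz : τ z = ζ ^ s * z := by rw [hs, div_mul_cancel₀ _ hz0]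
      have hτσ : τ (σ z) = (ζ ^ t) ^ s * σ z := by
        rw [← AlgEquiv.mul_apply, hcomm, AlgEquiv.mul_apply, hτz, map_mul, map_pow, ht]
      have hζ0 := hζ.ne_zero hp.ne_zero
      rw [map_div₀, map_pow, hτσ, hτz, mul_pow, pow_right_comm,
        mul_div_mul_left _ _ (pow_ne_zero _ (pow_ne_zero _ hζ0))]
    obtain ⟨x, hx⟩ := this
    exact hx ▸ x.2
  have hle : K⟮ζ⟯.toSubfield ≤ Subfield.closure {algebraMap K E c, ζ} := by
    refine Subfield.closure_le.2 (Set.union_subset ?_ ?_)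
    · rintro _ ⟨x, rfl⟩
      exact Subfield.closure_mono (by simp) (hKE x)
    · rintro _ rfl
      exact Subfield.subset_closure (by simp)
  have hemem : algebraMap K E e ^ (t - 1) ∈ Subfield.closure {algebraMap K E c, ζ} :=
    pow_mem (Subfield.closure_mono (by simp) (hKE e)) _
  refine pow_mul_ne_sub_one_pow hp hcE heE hceE hζ (by lia) htp
    (div_mem (hle hw) hemem) ?_
  rw [div_pow, div_pow, pow_right_comm, hz, pow_right_comm, ← hceE, ← map_pow, hz, map_mul,
    map_sub, map_one, ← ht, AlgEquiv.commutes]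
  have h1 : ζ ^ t - 1 ≠ 0 :=
    sub_ne_zero.2 (hζ.pow_ne_one_of_pos_of_lt ht0 htp)
  obtain ⟨m, rfl⟩ := Nat.exists_eq_succ_of_ne_zero ht0
  rw [Nat.succ_sub_one]
  field_simp
  rw [mul_pow, Nat.succ_eq_add_one]
  ring

theorem aeval_aPoly (d : ℕ) {F : Type*} [CommRing F] (c : F) (k : ℕ) :
    aeval c (aPoly d k) = aSeq d c k := by
  induction k with
  | zero => simp [aPoly, aSeq]
  | succ k ih => simp [aPoly, aSeq, ih]

theorem map_aSeq (d : ℕ) {F F' : Type*} [CommRing F] [CommRing F'] (φ : F →+* F') (c : F)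
    (k : ℕ) : φ (aSeq d c k) = aSeq d (φ c) k := by
  induction k with
  | zero => simp [aSeq]
  | succ k ih => simp [aSeq, ih]

theorem aSeq_mem_closure (d : ℕ) {F : Type*} [CommRing F] (c : F) (k : ℕ) :
    aSeq d c k ∈ Subring.closure {c} := by
  induction k with
  | zero => exact zero_mem _
  | succ k ih => exact add_mem (pow_mem ih d) (Subring.subset_closure rfl)

theorem exists_aPoly_succ_eq_X_mul {d : ℕ} (hd : 2 ≤ d) (k : ℕ) :
    ∃ h : ℤ[X], aPoly d (k + 1) = X * h ∧ h.eval 0 = 1 := by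
  induction k with
  | zero => exact ⟨1, by simp [aPoly, show d ≠ 0 by lia], by simp⟩
  | succ k ih =>
    obtain ⟨h, hk, -⟩ := ih
    obtain ⟨m, rfl⟩ := Nat.exists_eq_add_of_le' hd
    refine ⟨(X * h) ^ (m + 1) * h + 1, ?_, by simp⟩
    rw [aPoly, hk]
    ring

theorem monic_aPoly_succ {d : ℕ} (hd : 2 ≤ d) (k : ℕ) :
    (aPoly d (k + 1)).Monic ∧ (aPoly d (k + 1)).natDegree = d ^ k := by
  induction k with
  | zero => simp [aPoly, show d ≠ 0 by lia]
  | succ k ih =>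
    have hdeg : (X : ℤ[X]).degree < (aPoly d (k + 1) ^ d).degree := by
      rw [degree_X, degree_eq_natDegree (ih.1.pow d).ne_zero, ih.1.natDegree_pow, ih.2]
      exact_mod_cast lt_of_lt_of_le hd (Nat.le_mul_of_pos_right d (by positivity))
    refine ⟨(ih.1.pow d).add_of_left hdeg, ?_⟩
    rw [aPoly, natDegree_add_eq_left_of_degree_lt hdeg, ih.1.natDegree_pow, ih.2, pow_succ']

theorem isIntegral_of_aSeq_eq_zero {d : ℕ} (hd : 2 ≤ d) {F : Type*} [CommRing F] {c : F} {k : ℕ}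
    (hk : k ≠ 0) (h : aSeq d c k = 0) : IsIntegral ℤ c := by
  obtain ⟨k, rfl⟩ := Nat.exists_eq_succ_of_ne_zero hk
  exact ⟨_, (monic_aPoly_succ hd k).1, by rw [← aeval_def, aeval_aPoly, h]⟩

theorem map_fIter (d : ℕ) {F F' : Type*} [CommRing F] [CommRing F'] (φ : F →+* F') (c : F)
    (k : ℕ) : (fIter d c k).map φ = fIter d (φ c) k := by
  induction k with
  | zero => simp [fIter]
  | succ k ih => simp [fIter, ih]

theorem eval_fIter_succ (d : ℕ) {F : Type*} [CommRing F] (c x : F) (k : ℕ) :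
    (fIter d c (k + 1)).eval x = (fIter d c k).eval (x ^ d + c) := by
  induction k with
  | zero => simp [fIter]
  | succ k ih =>
    rw [fIter, eval_add, eval_pow, ih]
    simp [fIter]

theorem eval_fIter_aSeq (d : ℕ) {F : Type*} [CommRing F] (c : F) (i k : ℕ) :
    (fIter d c k).eval (aSeq d c i) = aSeq d c (i + k) := by
  induction k with
  | zero => simp [fIter]
  | succ k ih => simp [fIter, ih, aSeq]

theorem eval_fIter_eq_zero_of_pow_eq {d : ℕ} (hd : d ≠ 0) {F : Type*} [CommRing F] {c ζ z : F}
    (hζ : ζ ^ d = 1) {N : ℕ} (hN : 2 ≤ N) (hcN : aSeq d c N = 0) (hz : z ^ d = (ζ - 1) * c) :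
    (fIter d c N).eval z = 0 := by
  obtain ⟨m, rfl⟩ := Nat.exists_eq_add_of_le' hN
  have h2 : ((ζ - 1) * c + c) ^ d + c = aSeq d c 2 := by
    rw [sub_one_mul, sub_add_cancel, mul_pow, hζ, one_mul]
    simp [aSeq, hd]
  rw [eval_fIter_succ, eval_fIter_succ, hz, h2, eval_fIter_aSeq, add_comm, hcN]

theorem monic_fIter {d : ℕ} (hd : d ≠ 0) {F : Type*} [Field F] (c : F) (k : ℕ) :
    (fIter d c k).Monic ∧ (fIter d c k).natDegree ≠ 0 := by
  induction k with
  | zero => simp [fIter]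
  | succ k ih =>
    have hpos : 0 < (fIter d c k ^ d).natDegree := by
      rw [ih.1.natDegree_pow]
      exact Nat.pos_of_ne_zero (mul_ne_zero hd ih.2)
    refine ⟨(ih.1.pow d).add_of_left (degree_C_le.trans_lt (natDegree_pos_iff_degree_pos.1 hpos)),
      ?_⟩
    rw [fIter, natDegree_add_C]
    exact hpos.ne'

/-- A Gleason root of period `n ≥ 2` is nonzero and a root of some `a_k` with `k ≥ 2`. -/
theorem isGleasonRoot.ne_zero_and_exists {d n : ℕ} {c₀ : ℂ} (hd : 2 ≤ d) (hn : 2 ≤ n)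
    (h : isGleasonRoot d n c₀) : c₀ ≠ 0 ∧ ∃ k, 2 ≤ k ∧ aSeq d c₀ k = 0 := by
  obtain ⟨g, hg, hgc⟩ := h
  have hc₀ : c₀ ≠ 0 := by
    rintro rfl
    have hfac (k : ℕ) (hk : k ≠ 0) : ∃ h : ℤ[X], aPoly d k = X * h ∧ h.eval 0 = 1 := by
      obtain ⟨k, rfl⟩ := Nat.exists_eq_succ_of_ne_zero hk
      exact exists_aPoly_succ_eq_X_mul hd k
    choose! q hq hq1 using hfac
    have hprod (e : ℕ → ℕ) : ∏ k ∈ n.divisors, aPoly d k ^ e k =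
        X ^ (∑ k ∈ n.divisors, e k) * ∏ k ∈ n.divisors, q k ^ e k := by
      rw [← Finset.prod_pow_eq_pow_sum, ← Finset.prod_mul_distrib]
      refine Finset.prod_congr rfl fun k hk ↦ ?_
      rw [hq k (Nat.pos_of_mem_divisors hk).ne', mul_pow]
    have hone (e : ℕ → ℕ) : (∏ k ∈ n.divisors, q k ^ e k).eval 0 = 1 := by
      rw [eval_prod]
      refine Finset.prod_eq_one fun k hk ↦ ?_
      rw [eval_pow, hq1 k (Nat.pos_of_mem_divisors hk).ne', one_pow]
    have hsum : ∑ k ∈ n.divisors, (ArithmeticFunction.moebius (n / k)).toNat =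
        ∑ k ∈ n.divisors, (-(ArithmeticFunction.moebius (n / k))).toNat := by
      have h0 : ∑ k ∈ n.divisors, ArithmeticFunction.moebius (n / k) = 0 := by
        rw [Nat.sum_div_divisors, ← ArithmeticFunction.coe_mul_zeta_apply,
          ArithmeticFunction.moebius_mul_coe_zeta, ArithmeticFunction.one_apply_ne (by lia)]
      zify
      rw [← sub_eq_zero, ← Finset.sum_sub_distrib, ← h0]
      exact Finset.sum_congr rfl fun k _ ↦ Int.toNat_sub_toNat_neg _
    rw [hprod, hprod, hsum, mul_left_comm] at hg
    have := congrArg (eval 0) (mul_left_cancel₀ (pow_ne_zero _ X_ne_zero) hg)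
    rw [eval_mul, hone, hone, mul_one] at this
    rw [← map_zero (algebraMap ℤ ℂ), aeval_algebraMap_apply, coe_aeval_eq_eval, this] at hgc
    simp at hgc
  refine ⟨hc₀, ?_⟩
  have hz := congrArg (aeval c₀) hg
  rw [map_mul, hgc, zero_mul, map_prod, eq_comm, Finset.prod_eq_zero_iff] at hz
  obtain ⟨k, hk, hkz⟩ := hz
  rw [map_pow, aeval_aPoly] at hkz
  have hk0 : aSeq d c₀ k = 0 := eq_zero_of_pow_eq_zero hkz
  refine ⟨k, ?_, hk0⟩
  have := (Nat.pos_of_mem_divisors hk).ne'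
  rcases eq_or_ne k 1 with rfl | h1
  · simp [aSeq, show d ≠ 0 by lia, hc₀] at hk0
  · lia

theorem exists_mul_ne_mul_of_aSeq_eq_zero {K : Type*} [Field K] [CharZero K] {d : ℕ}
    (hd : d.Prime) (hodd : Odd d) {c : K} (hc0 : c ≠ 0) {N : ℕ} (hN : 2 ≤ N)
    (hcN : aSeq d c N = 0) (hK : ∀ x : K, x ∈ Subfield.closure {c}) :
    ∃ σ τ : (fIter d c N).SplittingField ≃ₐ[K] (fIter d c N).SplittingField,
      σ * τ ≠ τ * σ := by
  set E := (fIter d c N).SplittingField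
  have : IsGalois K E := IsGalois.mk
  have : CharZero E := charZero_of_injective_algebraMap (algebraMap K E).injective
  let Ω := AlgebraicClosure E
  let i : E →+* Ω := algebraMap E Ω
  have : NeZero (d : Ω) := ⟨Nat.cast_ne_zero.2 hd.ne_zero⟩
  obtain ⟨ζ, hζ⟩ := HasEnoughRootsOfUnity.exists_primitiveRoot Ω d
  set b : Ω := i (algebraMap K E c) with hb
  have hbN : aSeq d b N = 0 := by rw [hb, ← map_aSeq, ← map_aSeq, hcN, map_zero, map_zero]
  obtain ⟨z, hz⟩ := IsAlgClosed.exists_pow_nat_eq ((ζ - 1) * b) hd.pos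
  have hroot : (fIter d b N).eval z = 0 :=
    eval_fIter_eq_zero_of_pow_eq hd.ne_zero hζ.pow_eq_one hN hbN hz
  have hsplit : (fIter d (algebraMap K E c) N).Splits := by
    rw [← map_fIter]
    exact SplittingField.splits _
  obtain ⟨z, rfl⟩ := hsplit.mem_range_of_isRoot (monic_fIter hd.ne_zero _ N).1.ne_zero (i := i)
    (x := z) (by rw [IsRoot.def, map_fIter, hroot])
  have hcE0 : algebraMap K E c ≠ 0 := by simpa using hc0
  have hb0 : b ≠ 0 := by simpa [hb] using hcE0
  obtain ⟨ζ, rfl⟩ : ζ ∈ i.range := by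
    refine ⟨z ^ d / algebraMap K E c + 1, ?_⟩
    rw [map_add, map_div₀, map_pow, hz, map_one, ← hb, mul_div_cancel_right₀ _ hb0, sub_add_cancel]
  have hce : c = (-aSeq d c (N - 1)) ^ d := by
    obtain ⟨m, rfl⟩ := Nat.exists_eq_add_of_le' hN
    rw [hodd.neg_pow, eq_neg_iff_add_eq_zero, add_comm]
    exact hcN
  refine exists_mul_ne_mul_of_pow_eq hd hodd (z := z)
    (isIntegral_of_aSeq_eq_zero hd.two_le (by lia) hcN) hc0
    (neg_mem (aSeq_mem_closure d c _)) hce hK (hζ.of_map_of_injective i.injective) ?_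
  refine i.injective ?_
  rw [map_pow, hz, map_mul, map_sub, map_one]

theorem mem_subfieldClosure_gen (c₀ : ℂ) (x : ℚ⟮c₀⟯) :
    x ∈ Subfield.closure {AdjoinSimple.gen ℚ c₀} := by
  have hx : algebraMap ℚ⟮c₀⟯ ℂ x ∈ (Subfield.closure {AdjoinSimple.gen ℚ c₀}).map
      (algebraMap ℚ⟮c₀⟯ ℂ) := by
    have hle : ℚ⟮c₀⟯.toSubfield ≤ (Subfield.closure {AdjoinSimple.gen ℚ c₀}).map
        (algebraMap ℚ⟮c₀⟯ ℂ) := by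
      refine Subfield.closure_le.2 (Set.union_subset ?_ ?_)
      · rintro _ ⟨r, rfl⟩
        rw [eq_ratCast]
        exact SubfieldClass.ratCast_mem _ r
      · intro y hy
        rw [Set.mem_singleton_iff.1 hy]
        exact ⟨AdjoinSimple.gen ℚ c₀, Subfield.subset_closure rfl, rfl⟩
    exact hle x.2
  obtain ⟨y, hy, hyx⟩ := hx
  rwa [← (algebraMap ℚ⟮c₀⟯ ℂ).injective hyx]

/-- Let `d` be an odd prime, `c₀` a Gleason parameter of period `n ≥ 2`,
and `K = ℚ(c₀)`. Then some iterated Galois group `Gal(f_{d,c₀}^N / K)` is non-abelian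
(equivalently, the arboreal Galois group `G_∞(f_{d,c₀}, 0)` is non-abelian). -/
theorem stmt7 (d : ℕ) (hd : Nat.Prime d) (hodd : Odd d) (n : ℕ) (hn : 2 ≤ n)
    (c₀ : ℂ) (hc₀ : isGleasonRoot d n c₀) :
    ∃ N : ℕ, 1 ≤ N ∧
      ∃ σ τ : (fIter d (IntermediateField.AdjoinSimple.gen ℚ c₀) N).Gal,
        σ * τ ≠ τ * σ := by
  obtain ⟨hc0, N, hN, hcN⟩ := hc₀.ne_zero_and_exists hd.two_le hn
  have hinj : Function.Injective (algebraMap ℚ⟮c₀⟯ ℂ) := (algebraMap ℚ⟮c₀⟯ ℂ).injective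
  have hgen : algebraMap ℚ⟮c₀⟯ ℂ (AdjoinSimple.gen ℚ c₀) = c₀ := AdjoinSimple.algebraMap_gen ℚ c₀
  refine ⟨N, by lia, exists_mul_ne_mul_of_aSeq_eq_zero hd hodd ?_ hN ?_
    (mem_subfieldClosure_gen c₀)⟩
  · rintro h
    rw [h, map_zero] at hgen
    exact hc0 hgen.symm
  · exact hinj (by rw [map_aSeq, hgen, hcN, map_zero])
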